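/- Define $a(t) = e^{2t}\big(\cosh(t)\log\big(\tfrac{\cosh(t)+1}{\cosh(t)-1}\big) - 2\big)$, $G(r) = \dfrac{a(2r)\big(e^{-r} + \tfrac{e^{-3r}}{3}\big)}{2\arctan(\sinh r)\cosh^2 r + 2\sinh r}$ for $r > 0$, $r_{\mathrm{sys}}(t) = \max\big\{ t/4,\ \operatorname{arcsinh}\big(1/\sinh(t/2)\big) \big\}$ for $t > 0$, and $H_{\mathrm{sys}}(a,b) = \int_a^b \frac{dt}{\sqrt{\tfrac{2t}{\pi}\big(1 + G(r_{\mathrm{sys}}(t))\big)}}$. Then for all $0 \le a < b$ one has $H_{\mathrm{sys}}(a,b) \ge 2\big(\sqrt{b} - \sqrt{a}\big)$, and for all $t > 0$ one has $\frac{H_{\mathrm{sys}}(0,t)}{\sqrt{2\pi t}} \ge \sqrt{\tfrac{2}{\pi}}$. -/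

import Mathlib

/-- `a(t) = e^{2t} (cosh t * log((cosh t + 1)/(cosh t - 1)) - 2)`. -/
noncomputable def aFun (t : ℝ) : ℝ :=
  Real.exp (2 * t) * (Real.cosh t * Real.log ((Real.cosh t + 1) / (Real.cosh t - 1)) - 2)

/-- `G(r) = a(2r)(e^{-r} + e^{-3r}/3) / (2 arctan(sinh r) cosh² r + 2 sinh r)`. -/
noncomputable def G (r : ℝ) : ℝ :=
  aFun (2 * r) * (Real.exp (-r) + Real.exp (-3 * r) / 3) /
    (2 * Real.arctan (Real.sinh r) * Real.cosh r ^ 2 + 2 * Real.sinh r)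

/-- `r_sys(t) = max (t/4) (arsinh (1 / sinh (t/2)))`. -/
noncomputable def rsys (t : ℝ) : ℝ :=
  max (t / 4) (Real.arsinh (1 / Real.sinh (t / 2)))

/-- `H_sys(a, b) = ∫_a^b dt / √((2t/π)(1 + G(r_sys t)))`. -/
noncomputable def Hsys (a b : ℝ) : ℝ :=
  ∫ t in a..b, 1 / Real.sqrt (2 * t / Real.pi * (1 + G (rsys t)))

open Set in
/-- The Taylor bound for `log ((1 + x) / (1 - x))` with explicit remainder. -/
lemma log_one_add_div_one_sub_le {x : ℝ} (hx0 : 0 ≤ x) (hx1 : x < 1) :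
    Real.log ((1 + x) / (1 - x)) ≤
      2 * (x + x ^ 3 / 3 + x ^ 5 / 5 + x ^ 7 / (7 * (1 - x ^ 2))) := by
  let f : ℝ → ℝ := fun x =>
    2 * (x + x ^ 3 / 3 + x ^ 5 / 5 + x ^ 7 / (7 * (1 - x ^ 2)))
      - (Real.log (1 + x) - Real.log (1 - x))
  have hd : ∀ y ∈ Ico (0 : ℝ) 1,
      HasDerivAt f (4 * y ^ 8 / (7 * (1 - y ^ 2) ^ 2)) y := by
    rintro y ⟨hy0, hy1⟩
    have h1 : (1 + y) ≠ 0 := by linarith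
    have h2 : (1 - y) ≠ 0 := by linarith
    have h3 : (1 - y ^ 2) ≠ 0 := by nlinarith
    have hi := hasDerivAt_id' y
    have ha := (hi.const_add 1).log h1
    have hb := (hi.const_sub 1).log h2
    have hc := (hi.pow 7).div (((hi.pow 2).const_sub 1).const_mul 7)
      (mul_ne_zero (by norm_num) h3)
    have := ((((hi.add ((hi.pow 3).div_const 3)).add ((hi.pow 5).div_const 5)).add hc).const_mul
      2).sub (ha.sub hb)
    refine HasDerivAt.congr_deriv (f := f) this ?_
    have e : 1 - y ^ 2 = (1 + y) * (1 - y) := by ring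
    simp only [Pi.pow_apply]
    rw [e]
    field_simp
    push_cast
    ring
  have hm : MonotoneOn f (Ico 0 1) := by
    apply monotoneOn_of_deriv_nonneg (convex_Ico 0 1)
    · exact fun y hy => (hd y hy).continuousAt.continuousWithinAt
    · exact fun y hy => (hd y (interior_subset hy)).differentiableAt.differentiableWithinAt
    · intro y hy
      rw [(hd y (interior_subset hy)).deriv]
      positivity
  have h := hm ⟨le_rfl, one_pos⟩ ⟨hx0, hx1⟩ hx0
  rw [Real.log_div (by linarith) (by linarith)]
  simp only [f] at h
  norm_num at h
  linarith

lemma two_mul_le_log_one_add_div_one_sub {x : ℝ} (hx0 : 0 ≤ x) (hx1 : x < 1) :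
    2 * x ≤ Real.log ((1 + x) / (1 - x)) := by
  have h := Real.sum_range_le_log_div hx0 hx1 1
  norm_num at h
  linarith

open Set in
/-- A partial sum of the alternating series bounds `arctan` from below. -/
lemma sub_add_sub_le_arctan {x : ℝ} (hx : 0 ≤ x) :
    x - x ^ 3 / 3 + x ^ 5 / 5 - x ^ 7 / 7 ≤ Real.arctan x := by
  let f : ℝ → ℝ := fun x => Real.arctan x - (x - x ^ 3 / 3 + x ^ 5 / 5 - x ^ 7 / 7)
  have hd : ∀ y : ℝ, HasDerivAt f (y ^ 8 / (1 + y ^ 2)) y := by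
    intro y
    have hi := hasDerivAt_id' y
    have := (Real.hasDerivAt_arctan y).sub
      (((hi.sub ((hi.pow 3).div_const 3)).add ((hi.pow 5).div_const 5)).sub
        ((hi.pow 7).div_const 7))
    refine HasDerivAt.congr_deriv (f := f) this ?_
    have : 1 + y ^ 2 ≠ 0 := by positivity
    field_simp
    push_cast
    ring
  have hm : Monotone f :=
    monotone_of_hasDerivAt_nonneg hd fun y => by simp only [Pi.zero_apply]; positivity
  have h := hm hx
  simp only [f] at h
  norm_num at h
  linarith

/-- `aFun` in terms of `x = 1 / cosh t`. -/
lemma aFun_eq (t : ℝ) :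
    aFun t = Real.exp (2 * t) * (Real.cosh t *
      Real.log ((1 + (Real.cosh t)⁻¹) / (1 - (Real.cosh t)⁻¹)) - 2) := by
  have hc := Real.cosh_pos t
  rw [aFun]
  congr 4
  rw [← mul_div_mul_left (1 + (Real.cosh t)⁻¹) (1 - (Real.cosh t)⁻¹) hc.ne']
  congr 1 <;> field_simp

lemma aFun_nonneg {t : ℝ} (ht : 0 < t) : 0 ≤ aFun t := by
  have hc : 1 < Real.cosh t := Real.one_lt_cosh.2 ht.ne'
  have hc0 : 0 < Real.cosh t := by linarith
  have h := two_mul_le_log_one_add_div_one_sub (inv_nonneg.2 hc0.le) (inv_lt_one_of_one_lt₀ hc)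
  have h' := mul_le_mul_of_nonneg_left h hc0.le
  rw [mul_left_comm, mul_inv_cancel₀ hc0.ne'] at h'
  rw [aFun_eq]
  exact mul_nonneg (Real.exp_pos _).le (by linarith)

/-- An upper bound for `aFun t` once `t` is large enough. -/
lemma aFun_le_of_exp_le {t : ℝ} (ht : 0 < t) (hy : Real.exp (-2 * t) ≤ 0.0875) :
    aFun t ≤ 2.78 := by
  have hc : 1 < Real.cosh t := Real.one_lt_cosh.2 ht.ne'
  have hc0 : 0 < Real.cosh t := by linarith
  have h := log_one_add_div_one_sub_le (inv_nonneg.2 hc0.le) (inv_lt_one_of_one_lt₀ hc)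
  have h' := mul_le_mul_of_nonneg_left h hc0.le
  set w := Real.exp (-t) with hw
  have hw0 : 0 < w := Real.exp_pos _
  have hyw : Real.exp (-2 * t) = w ^ 2 := by rw [hw, ← Real.exp_nat_mul]; congr 1; push_cast; ring
  have hE : Real.exp (2 * t) = (w ^ 2)⁻¹ := by rw [← hyw, ← Real.exp_neg]; congr 1; ring
  have hE1 : Real.exp t = w⁻¹ := by rw [hw, ← Real.exp_neg, neg_neg]
  have hC : Real.cosh t = (1 + w ^ 2) / (2 * w) := by
    rw [Real.cosh_eq, hE1, ← hw]; field_simp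
  rw [hyw] at hy
  have hy1 : 0 < 1 - w ^ 2 := by linarith
  rw [aFun_eq]
  refine (mul_le_mul_of_nonneg_left (sub_le_sub_right h' 2) (Real.exp_pos _).le).trans ?_
  have key : Real.exp (2 * t) * (Real.cosh t * (2 * ((Real.cosh t)⁻¹ + (Real.cosh t)⁻¹ ^ 3 / 3
      + (Real.cosh t)⁻¹ ^ 5 / 5 + (Real.cosh t)⁻¹ ^ 7 / (7 * (1 - (Real.cosh t)⁻¹ ^ 2)))) - 2)
      = (8 / 3 * (1 + w ^ 2) ^ 2 + 32 / 5 * w ^ 2 + 128 / 7 * (w ^ 2) ^ 2 / (1 - w ^ 2) ^ 2)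
        / (1 + w ^ 2) ^ 4 := by
    have e : 1 - (Real.cosh t)⁻¹ ^ 2 = (1 - w ^ 2) ^ 2 / (1 + w ^ 2) ^ 2 := by
      rw [hC]; field_simp; ring
    rw [e, hC, hE]
    field_simp
    ring
  rw [key]
  generalize w ^ 2 = y at *
  have hy0 : 0 ≤ y := by by_contra hn; nlinarith [Real.exp_pos (-2 * t)]
  rw [div_le_iff₀ (by positivity)]
  have hr : 128 / 7 * y ^ 2 / (1 - y) ^ 2 ≤ 22.2 * y ^ 2 := by
    rw [div_le_iff₀ (by positivity)]
    have : (0.9125 : ℝ) ^ 2 ≤ (1 - y) ^ 2 := by gcongr; linarith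
    nlinarith [mul_le_mul_of_nonneg_left this (sq_nonneg y), sq_nonneg y]
  nlinarith [pow_nonneg hy0 3, pow_nonneg hy0 4, mul_nonneg hy0 (sub_nonneg.2 hy)]

lemma G_nonneg {r : ℝ} (hr : 0 < r) : 0 ≤ G r := by
  have hs : 0 < Real.sinh r := Real.sinh_pos_iff.2 hr
  have ha : 0 ≤ Real.arctan (Real.sinh r) := Real.arctan_nonneg.2 hs.le
  have := aFun_nonneg (t := 2 * r) (by linarith)
  unfold G
  positivity

/-- Past the point where `sinh r * sinh (2 * r) = 1`, the function `1 + G` is at most `π / 2`. -/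
lemma one_add_G_le {r : ℝ} (hr : 0 < r) (h : 1 ≤ Real.sinh r * Real.sinh (2 * r)) :
    1 + G r ≤ Real.pi / 2 := by
  have hs : 0 < Real.sinh r := Real.sinh_pos_iff.2 hr
  have hc : 0 < Real.cosh r := Real.cosh_pos r
  have hsq := Real.cosh_sq r
  have hes : Real.exp r = Real.cosh r + Real.sinh r := (Real.cosh_add_sinh r).symm
  rw [Real.sinh_two_mul] at h
  set s := Real.sinh r with hsdef
  set c := Real.cosh r
  have hs1 : 0.6477 ≤ s := by
    by_contra! hlt
    have h1 : s ^ 2 < 0.6477 ^ 2 := by gcongr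
    have h2 : c ^ 2 < 1.1916 ^ 2 := by rw [hsq]; norm_num at h1 ⊢; linarith
    have h3 : c < 1.1916 := lt_of_pow_lt_pow_left₀ 2 (by norm_num) h2
    have h4 : s ^ 2 * c ≤ 0.6477 ^ 2 * 1.1916 := by gcongr
    norm_num at h4
    nlinarith
  have hc2 : 1.4195 ≤ c ^ 2 := by rw [hsq]; nlinarith
  have hc1 : 1.1914 ≤ c := by
    by_contra! hlt
    nlinarith
  set q := Real.exp (-r) with hq
  have hq0 : 0 < q := Real.exp_pos _
  have hqe : q * (c + s) = 1 := by rw [← hes, hq, ← Real.exp_add]; simp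
  have hq1 : q ≤ 0.5438 := by
    by_contra! hlt
    nlinarith
  have hq3 : Real.exp (-3 * r) = q ^ 3 := by
    rw [hq, ← Real.exp_nat_mul]; congr 1; push_cast; ring
  have hq4 : Real.exp (-2 * (2 * r)) = q ^ 4 := by
    rw [hq, ← Real.exp_nat_mul]; congr 1; push_cast; ring
  have ha : aFun (2 * r) ≤ 2.78 := by
    apply aFun_le_of_exp_le (by linarith)
    rw [hq4]
    calc q ^ 4 ≤ 0.5438 ^ 4 := by gcongr
      _ ≤ 0.0875 := by norm_num
  have hat : 0.573 ≤ Real.arctan s := by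
    refine le_trans ?_ (Real.arctan_mono hs1)
    refine le_trans ?_ (sub_add_sub_le_arctan (by norm_num))
    norm_num
  have hN : q + q ^ 3 / 3 ≤ 0.5975 := by
    have : q ^ 3 ≤ 0.5438 ^ 3 := by gcongr
    norm_num at this ⊢
    linarith
  have hD : 2.922 ≤ 2 * Real.arctan s * c ^ 2 + 2 * s := by
    have : 0.573 * 1.4195 ≤ Real.arctan s * c ^ 2 := by gcongr
    norm_num at this ⊢
    linarith
  have hG : G r ≤ 0.5705 := by
    rw [G, hq3, ← hsdef, ← hq, div_le_iff₀ (by linarith)]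
    calc aFun (2 * r) * (q + q ^ 3 / 3) ≤ 2.78 * 0.5975 := by gcongr
      _ ≤ 0.5705 * 2.922 := by norm_num
      _ ≤ _ := by gcongr
  linarith [Real.pi_gt_d4]

lemma rsys_pos {t : ℝ} (ht : 0 < t) : 0 < rsys t :=
  lt_max_of_lt_left (by linarith)

lemma one_le_sinh_rsys_mul {t : ℝ} (ht : 0 < t) :
    1 ≤ Real.sinh (rsys t) * Real.sinh (2 * rsys t) := by
  have hp : 0 < Real.sinh (t / 2) := Real.sinh_pos_iff.2 (by linarith)
  have h1 : 1 / Real.sinh (t / 2) ≤ Real.sinh (rsys t) := by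
    rw [← Real.sinh_arsinh (1 / Real.sinh (t / 2))]
    exact Real.sinh_le_sinh.2 (le_max_right _ _)
  have h2 : Real.sinh (t / 2) ≤ Real.sinh (2 * rsys t) := by
    apply Real.sinh_le_sinh.2
    linarith [show t / 4 ≤ rsys t from le_max_left _ _]
  have h0 : 0 ≤ Real.sinh (rsys t) := Real.sinh_nonneg_iff.2 (rsys_pos ht).le
  calc 1 = 1 / Real.sinh (t / 2) * Real.sinh (t / 2) := by field_simp
    _ ≤ _ := by gcongr

lemma measurable_G_rsys : Measurable fun t => G (rsys t) := by
  have hr : Measurable rsys := by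
    unfold rsys
    have := Real.continuous_arsinh.measurable
    fun_prop
  have hG : Measurable G := by
    unfold G aFun
    fun_prop
  exact hG.comp hr

lemma integral_one_div_sqrt (a b : ℝ) (ha : 0 ≤ a) (hab : a ≤ b) :
    IntervalIntegrable (fun t => 1 / Real.sqrt t) MeasureTheory.volume a b ∧
      ∫ t in a..b, 1 / Real.sqrt t = 2 * (Real.sqrt b - Real.sqrt a) := by
  have hcongr : Set.EqOn (fun t : ℝ => t ^ (-(1 / 2) : ℝ)) (fun t => 1 / Real.sqrt t)
      (Set.uIcc a b) := by
    intro t ht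
    rw [Set.uIcc_of_le hab] at ht
    simp only [Real.rpow_neg (ha.trans ht.1), Real.sqrt_eq_rpow, one_div]
  refine ⟨(intervalIntegral.intervalIntegrable_rpow' (by norm_num)).congr
    (hcongr.mono Set.uIoc_subset_uIcc), ?_⟩
  rw [← intervalIntegral.integral_congr hcongr, integral_rpow (Or.inl (by norm_num)),
    Real.sqrt_eq_rpow, Real.sqrt_eq_rpow]
  norm_num
  ring

lemma two_mul_sqrt_sub_sqrt_le_Hsys {a b : ℝ} (ha : 0 ≤ a) (hab : a < b) :
    2 * (Real.sqrt b - Real.sqrt a) ≤ Hsys a b := by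
  obtain ⟨hint, hval⟩ := integral_one_div_sqrt a b ha hab.le
  rw [← hval]
  refine intervalIntegral.integral_mono_on_of_le_Ioo hab.le hint ?_ ?_
  · refine (hint.const_mul (Real.sqrt (Real.pi / 2))).mono_fun ?_ ?_
    · have := measurable_G_rsys
      exact Measurable.aestronglyMeasurable (by fun_prop)
    · rw [Set.uIoc_of_le hab.le]
      filter_upwards [MeasureTheory.ae_restrict_mem measurableSet_Ioc] with t ht
      have ht0 : 0 < t := ha.trans_lt ht.1
      have hG := G_nonneg (rsys_pos ht0)
      rw [Real.norm_of_nonneg (by positivity), Real.norm_of_nonneg (by positivity)]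
      have e : Real.sqrt (Real.pi / 2) * (1 / Real.sqrt t) =
          1 / Real.sqrt (2 * t / Real.pi) := by
        rw [mul_one_div, ← Real.sqrt_div (by positivity), one_div, ← Real.sqrt_inv]
        congr 1
        field_simp
      rw [e]
      gcongr
      exact le_mul_of_one_le_right (by positivity) (by linarith)
  · intro t ht
    have ht0 : 0 < t := ha.trans_lt ht.1
    have hG := G_nonneg (rsys_pos ht0)
    have hG' := one_add_G_le (rsys_pos ht0) (one_le_sinh_rsys_mul ht0)
    gcongr
    calc 2 * t / Real.pi * (1 + G (rsys t)) ≤ 2 * t / Real.pi * (Real.pi / 2) := by gcongr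
      _ = t := by field_simp

/-- for `0 ≤ a < b`, `H_sys(a,b) ≥ 2(√b - √a)`, and for `t > 0`,
`H_sys(0,t)/√(2πt) ≥ √(2/π)`. -/
theorem stmt18 :
    (∀ a b : ℝ, 0 ≤ a → a < b → 2 * (Real.sqrt b - Real.sqrt a) ≤ Hsys a b) ∧
      ∀ t : ℝ, 0 < t → Real.sqrt (2 / Real.pi) ≤ Hsys 0 t / Real.sqrt (2 * Real.pi * t) := by
  refine ⟨fun a b ha hab => two_mul_sqrt_sub_sqrt_le_Hsys ha hab, fun t ht => ?_⟩
  rw [le_div_iff₀ (by positivity), ← Real.sqrt_mul (by positivity)]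
  have e : 2 / Real.pi * (2 * Real.pi * t) = 2 ^ 2 * t := by field_simp
  have h := two_mul_sqrt_sub_sqrt_le_Hsys le_rfl ht
  rw [Real.sqrt_zero, sub_zero] at h
  rwa [e, Real.sqrt_mul (by norm_num), Real.sqrt_sq (by norm_num)]
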